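/- Let (W,S) be a finitely generated Coxeter system with Cayley graph Λ(W,S), and let P be a Parallel Wall function for (W,S). For every edge path α in Λ connecting vertices a and b there is an L-approximation β to α such that every vertex of β lies on some geodesic edge path connecting a and b, and such that L ≤ (2P(1) + 1)·B(α). -/

import Mathlib

/-!
Common definitions: Cayley graph of a Coxeter system, walls, sides,
bracket numbers, edge paths, quasi-geodesics, tracking.
-/

namespace CoxTrack

variable {B : Type*} {W : Type*} [Group W] {M : CoxeterMatrix B}

/-- The word metric on the Cayley graph `Λ(W,S)`: `d u v = ℓ(u⁻¹ v)`. -/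
noncomputable def d (cs : CoxeterSystem M W) (u v : W) : ℕ := cs.length (u⁻¹ * v)

/-- `u` and `v` are adjacent vertices (endpoints of a common edge) of `Λ(W,S)`. -/
def Adj (cs : CoxeterSystem M W) (u v : W) : Prop := ∃ i : B, v = u * cs.simple i

/-- The edge with endpoints `u` and `v` belongs to the wall of the reflection `t`
(i.e. `t` fixes this edge setwise, interchanging its endpoints). -/
def EdgeInWall (cs : CoxeterSystem M W) (t u v : W) : Prop :=
  Adj cs u v ∧ t * u = v

/-- `v` is a vertex of `Q̄`, the union of the edges of the wall of the reflection `t`. -/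
def InWallBar (cs : CoxeterSystem M W) (t v : W) : Prop :=
  ∃ i : B, t * v = v * cs.simple i

/-- Vertices `u` and `v` lie on the same side of the wall of the reflection `t`. -/
def SameSide (cs : CoxeterSystem M W) (t u v : W) : Prop :=
  (cs.length (t * u) < cs.length u ↔ cs.length (t * v) < cs.length v)

/-- The wall of the reflection `t` separates the vertices `u` and `v`. -/
def SeparatesPts (cs : CoxeterSystem M W) (t u v : W) : Prop := ¬ SameSide cs t u v

/-- The walls of the reflections `t` and `t'` are parallel: they are distinct and
all edges of each one lie on one side of the other. -/
def Parallel (cs : CoxeterSystem M W) (t t' : W) : Prop :=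
  t ≠ t' ∧ (∀ u v, InWallBar cs t' u → InWallBar cs t' v → SameSide cs t u v)
         ∧ (∀ u v, InWallBar cs t u → InWallBar cs t v → SameSide cs t' u v)

/-- The walls of the reflections `t` and `t'` cross (they are distinct and not parallel). -/
def Crosses (cs : CoxeterSystem M W) (t t' : W) : Prop := t ≠ t' ∧ ¬ Parallel cs t t'

/-- The wall of the reflection `r` separates `Q̄` (for the wall of the reflection `t`)
from the vertex `p`. -/
def SepWallFromPt (cs : CoxeterSystem M W) (r t p : W) : Prop :=
  ∀ v, InWallBar cs t v → SeparatesPts cs r v p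

/-- The distance from the vertex `p` to `Q̄` (the wall of the reflection `t`),
measured to the nearest vertex of `Q̄`. -/
noncomputable def wallDist (cs : CoxeterSystem M W) (t p : W) : ℕ :=
  sInf {n : ℕ | ∃ v, InWallBar cs t v ∧ d cs p v = n}

/-- `v 0, v 1, …, v n` are the consecutive vertices of an edge path of length `n` in `Λ(W,S)`. -/
def IsPath (cs : CoxeterSystem M W) (v : ℕ → W) (n : ℕ) : Prop :=
  ∀ k, k < n → Adj cs (v k) (v (k+1))

/-- `v 0, …, v n` are the consecutive vertices of a geodesic edge path of length `n`. -/
def IsGeodesic (cs : CoxeterSystem M W) (v : ℕ → W) (n : ℕ) : Prop :=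
  IsPath cs v n ∧ d cs (v 0) (v n) = n

/-- `v 0, v 1, …` are the consecutive vertices of an edge path ray. -/
def IsRay (cs : CoxeterSystem M W) (v : ℕ → W) : Prop := ∀ k, Adj cs (v k) (v (k+1))

/-- A geodesic edge path ray. -/
def IsGeodesicRay (cs : CoxeterSystem M W) (v : ℕ → W) : Prop :=
  IsRay cs v ∧ ∀ j k, j ≤ k → d cs (v j) (v k) = k - j

/-- `…, v (-1), v 0, v 1, …` are the consecutive vertices of an edge path line. -/
def IsLine (cs : CoxeterSystem M W) (v : ℤ → W) : Prop := ∀ k : ℤ, Adj cs (v k) (v (k+1))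

/-- A geodesic edge path line. -/
def IsGeodesicLine (cs : CoxeterSystem M W) (v : ℤ → W) : Prop :=
  IsLine cs v ∧ ∀ j k : ℤ, j ≤ k → (d cs (v j) (v k) : ℤ) = k - j

/-- The set of (reflections of) walls bracketing the vertex `v k` of the edge path
`v 0, …, v n`: walls containing an edge of the path before `v k` and an edge after `v k`. -/
def Brackets (cs : CoxeterSystem M W) (v : ℕ → W) (n k : ℕ) : Set W :=
  {t | ∃ j m, j < k ∧ k ≤ m ∧ m < n ∧
      EdgeInWall cs t (v j) (v (j+1)) ∧ EdgeInWall cs t (v m) (v (m+1))}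

/-- The set of walls bracketing the vertex `v k` of the edge path ray `v`. -/
def BracketsRay (cs : CoxeterSystem M W) (v : ℕ → W) (k : ℕ) : Set W :=
  {t | ∃ j m, j < k ∧ k ≤ m ∧
      EdgeInWall cs t (v j) (v (j+1)) ∧ EdgeInWall cs t (v m) (v (m+1))}

/-- The set of walls bracketing the vertex `v k` of the edge path line `v`. -/
def BracketsLine (cs : CoxeterSystem M W) (v : ℤ → W) (k : ℤ) : Set W :=
  {t | ∃ j m : ℤ, j < k ∧ k ≤ m ∧
      EdgeInWall cs t (v j) (v (j+1)) ∧ EdgeInWall cs t (v m) (v (m+1))}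

/-- The edge path `v 0, …, v n` is a `(lam, eps)`-quasi-geodesic. -/
def IsQG (cs : CoxeterSystem M W) (lam eps : ℝ) (v : ℕ → W) (n : ℕ) : Prop :=
  IsPath cs v n ∧ ∀ j k, j ≤ n → k ≤ n →
    |(j : ℝ) - (k : ℝ)| ≤ lam * (d cs (v j) (v k) : ℝ) + eps

/-- The edge path ray `v` is a `(lam, eps)`-quasi-geodesic. -/
def IsQGRay (cs : CoxeterSystem M W) (lam eps : ℝ) (v : ℕ → W) : Prop :=
  IsRay cs v ∧ ∀ j k : ℕ, |(j : ℝ) - (k : ℝ)| ≤ lam * (d cs (v j) (v k) : ℝ) + eps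

/-- The edge path line `v` is a `(lam, eps)`-quasi-geodesic. -/
def IsQGLine (cs : CoxeterSystem M W) (lam eps : ℝ) (v : ℤ → W) : Prop :=
  IsLine cs v ∧ ∀ j k : ℤ, |(j : ℝ) - (k : ℝ)| ≤ lam * (d cs (v j) (v k) : ℝ) + eps

/-- `P` is a Parallel Wall function for `(W,S)`: for each positive integer `n`, every wall `Q`
and every vertex `p` at distance at least `P n` from `Q̄`, there are `n` distinct pairwise
parallel walls separating `Q̄` from `p`. -/
def IsParallelWallFn (cs : CoxeterSystem M W) (P : ℕ → ℕ) : Prop :=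
  ∀ n : ℕ, 0 < n → ∀ t p : W, cs.IsReflection t → P n ≤ wallDist cs t p →
    ∃ T : Finset W, T.card = n ∧ (∀ r ∈ T, cs.IsReflection r) ∧
      (∀ r ∈ T, ∀ r' ∈ T, r ≠ r' → Parallel cs r r') ∧
      (∀ r ∈ T, SepWallFromPt cs r t p)

/-- `w 0, …, w m` (with distinguished approximation vertices `w (c 0), …, w (c n)`)
is an `L`-approximation of the edge path `v 0, …, v n`: it is an edge path with the
same endpoints, the segment from `w (c i)` to `w (c (i+1))` is geodesic, and the
approximation vertex `w (c i)` is within `L` of `v i`. -/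
def IsApprox (cs : CoxeterSystem M W) (L : ℕ) (v : ℕ → W) (n : ℕ)
    (w : ℕ → W) (m : ℕ) (c : ℕ → ℕ) : Prop :=
  IsPath cs w m ∧ c 0 = 0 ∧ c n = m ∧ (∀ i, i < n → c i ≤ c (i+1)) ∧
  w 0 = v 0 ∧ w m = v n ∧
  (∀ i, i ≤ n → d cs (w (c i)) (v i) ≤ L) ∧
  (∀ i, i < n → d cs (w (c i)) (w (c (i+1))) = c (i+1) - c i)

/-! ### Parity of the right inversion sequence -/

section InversionParity

lemma end_mul_apply {α : Type*} (f g : Function.End α) (x : α) : (f * g) x = f (g x) := rfl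

open Classical in
/-- The action of the simple reflection `s i` on `W × ZMod 2` which conjugates the first
coordinate and changes the second one exactly when the first one is `s i`. -/
noncomputable def simpleFlip (cs : CoxeterSystem M W) (i : B) : Function.End (W × ZMod 2) :=
  fun p => (cs.simple i * p.1 * cs.simple i, p.2 + if p.1 = cs.simple i then 1 else 0)

open Classical in
lemma simpleFlip_mul_pow_apply (cs : CoxeterSystem M W) (i j : B) (k : ℕ) (t : W) (e : ZMod 2) :
    ((simpleFlip cs i * simpleFlip cs j) ^ k) (t, e) =
      ((cs.simple i * cs.simple j) ^ k * t * (cs.simple j * cs.simple i) ^ k,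
        e + ∑ l ∈ Finset.range (2 * k),
          if t = (cs.simple j * cs.simple i) ^ l * cs.simple j then 1 else 0) := by
  induction k with
  | zero => simp [Function.End.one_def]
  | succ k ih =>
    have hinv : (cs.simple j * cs.simple i) ^ k = ((cs.simple i * cs.simple j) ^ k)⁻¹ := by
      rw [← inv_pow]; simp
    have hcomm : cs.simple j * (cs.simple i * cs.simple j) ^ k =
        (cs.simple j * cs.simple i) ^ k * cs.simple j := by
      have h : SemiconjBy (cs.simple j) (cs.simple i * cs.simple j)
          (cs.simple j * cs.simple i) := by simp [SemiconjBy, mul_assoc]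
      exact (h.pow_right k).eq
    have h1 : (cs.simple i * cs.simple j) ^ k * t * (cs.simple j * cs.simple i) ^ k
          = cs.simple j ↔ t = (cs.simple j * cs.simple i) ^ (2 * k) * cs.simple j := by
      rw [two_mul, pow_add, mul_assoc _ _ (cs.simple j), ← hcomm, hinv,
        mul_inv_eq_iff_eq_mul, eq_inv_mul_iff_mul_eq]
    have h2 : cs.simple j * ((cs.simple i * cs.simple j) ^ k * t *
          (cs.simple j * cs.simple i) ^ k) * cs.simple j = cs.simple i ↔
        t = (cs.simple j * cs.simple i) ^ (2 * k + 1) * cs.simple j := by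
      have h3 : (cs.simple j * cs.simple i) ^ (2 * k + 1) * cs.simple j =
          ((cs.simple i * cs.simple j) ^ k)⁻¹ * ((cs.simple j * cs.simple i * cs.simple j) *
            (cs.simple i * cs.simple j) ^ k) := by
        rw [show 2 * k + 1 = k + 1 + k by ring, pow_add, pow_succ, mul_assoc _ _ (cs.simple j),
          ← hcomm, hinv]
        simp only [mul_assoc]
      rw [h3, eq_inv_mul_iff_mul_eq, hinv, ← mul_inv_eq_iff_eq_mul]
      generalize (cs.simple i * cs.simple j) ^ k * t * ((cs.simple i * cs.simple j) ^ k)⁻¹ = x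
      constructor
      · intro h
        rw [← h]
        simp [mul_assoc]
      · rintro rfl
        simp [mul_assoc]
    rw [pow_succ', end_mul_apply, ih, end_mul_apply]
    simp only [simpleFlip, h1, h2, mul_add, mul_one, Finset.sum_range_succ, Prod.mk.injEq]
    refine ⟨?_, by ring⟩
    rw [pow_succ', pow_succ]
    simp only [mul_assoc]

open Classical in
lemma isLiftable_simpleFlip (cs : CoxeterSystem M W) : M.IsLiftable (simpleFlip cs) := by
  intro i j
  have h1 := cs.simple_mul_simple_pow i j
  have h2 := cs.simple_mul_simple_pow' i j
  generalize M i j = m at h1 h2 ⊢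
  funext ⟨t, e⟩
  have hsum : (∑ l ∈ Finset.range (2 * m),
      if t = (cs.simple j * cs.simple i) ^ l * cs.simple j then (1 : ZMod 2) else 0) = 0 := by
    simp only [two_mul, Finset.sum_range_add, pow_add, h2, one_mul, CharTwo.add_self_eq_zero]
  rw [simpleFlip_mul_pow_apply, h1, h2, hsum]
  simp [Function.End.one_def]

/-- The parity of the number of occurrences of `t` in the right inversion sequence of any word
representing `w`. -/
noncomputable def invParity (cs : CoxeterSystem M W) (w t : W) : ZMod 2 :=
  (cs.lift ⟨simpleFlip cs, isLiftable_simpleFlip cs⟩ w (t, 0)).2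

lemma lift_simpleFlip_apply (cs : CoxeterSystem M W) (w t : W) (e : ZMod 2) :
    cs.lift ⟨simpleFlip cs, isLiftable_simpleFlip cs⟩ w (t, e) =
      (w * t * w⁻¹, e + invParity cs w t) := by
  classical
  unfold invParity
  induction w using cs.simple_induction_left generalizing t e with
  | one => simp [Function.End.one_def]
  | mul_simple_left w i ih =>
    rw [map_mul, end_mul_apply, end_mul_apply, ih, ih t 0]
    simp [simpleFlip, mul_assoc, add_assoc]

lemma invParity_one (cs : CoxeterSystem M W) (t : W) : invParity cs 1 t = 0 := by
  simp [invParity, Function.End.one_def]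

lemma invParity_mul (cs : CoxeterSystem M W) (u w t : W) :
    invParity cs (u * w) t = invParity cs w t + invParity cs u (w * t * w⁻¹) := by
  rw [invParity, map_mul, end_mul_apply, lift_simpleFlip_apply,
    lift_simpleFlip_apply, zero_add]

open Classical in
lemma invParity_simple (cs : CoxeterSystem M W) (i : B) (t : W) :
    invParity cs (cs.simple i) t = if t = cs.simple i then 1 else 0 := by
  simp [invParity, simpleFlip]

lemma invParity_self (cs : CoxeterSystem M W) {t : W} (ht : cs.IsReflection t) :
    invParity cs t t = 1 := by
  obtain ⟨w, i, rfl⟩ := ht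
  have h := invParity_mul cs w w⁻¹ (w * cs.simple i * w⁻¹)
  rw [mul_inv_cancel, invParity_one] at h
  rw [invParity_mul, invParity_mul]
  simp only [mul_assoc, inv_mul_cancel_left, inv_inv, inv_mul_cancel, mul_one,
    cs.simple_mul_simple_self, cs.inv_simple, one_mul, invParity_simple, if_true] at h ⊢
  rw [add_left_comm, ← h, add_zero]

lemma mem_rightInvSeq_of_invParity_ne_zero (cs : CoxeterSystem M W) (ω : List B) {t : W}
    (h : invParity cs (cs.wordProd ω) t ≠ 0) : t ∈ cs.rightInvSeq ω := by
  induction ω with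
  | nil => simp [invParity_one] at h
  | cons i ω ih =>
    rw [CoxeterSystem.rightInvSeq, List.mem_cons]
    by_contra! hne
    have h0 : invParity cs (cs.wordProd ω) t = 0 := by
      by_contra h1
      exact hne.2 (ih h1)
    rw [cs.wordProd_cons, invParity_mul, h0, invParity_simple, if_neg] at h
    · simp at h
    · rw [mul_inv_eq_iff_eq_mul, ← eq_inv_mul_iff_mul_eq, ← mul_assoc]
      exact hne.1

lemma isRightInversion_iff_invParity (cs : CoxeterSystem M W) {t : W} (ht : cs.IsReflection t)
    (w : W) : cs.IsRightInversion w t ↔ invParity cs w t = 1 := by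
  have key : ∀ w, invParity cs w t ≠ 0 → cs.IsRightInversion w t := by
    intro w h
    obtain ⟨ω, hω, rfl⟩ := cs.exists_isReduced w
    exact cs.isRightInversion_of_mem_rightInvSeq hω (mem_rightInvSeq_of_invParity_ne_zero cs ω h)
  constructor
  · intro h
    by_contra hne
    have h0 : invParity cs w t = 0 := by
      generalize invParity cs w t = x at hne
      fin_cases x
      · rfl
      · exact absurd rfl hne
    refine ht.isRightInversion_mul_left_iff.1 (key (w * t) ?_) h
    rw [invParity_mul, mul_inv_cancel_right, invParity_self cs ht, h0]
    simp
  · intro h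
    exact key w (by simp [h])

lemma isRightInversion_wordProd_iff_mem (cs : CoxeterSystem M W) {ω : List B}
    (hω : cs.IsReduced ω) (t : W) :
    cs.IsRightInversion (cs.wordProd ω) t ↔ t ∈ cs.rightInvSeq ω := by
  refine ⟨fun h => mem_rightInvSeq_of_invParity_ne_zero cs ω ?_,
    cs.isRightInversion_of_mem_rightInvSeq hω⟩
  rw [(isRightInversion_iff_invParity cs h.1 _).1 h]
  exact one_ne_zero

lemma finite_setOf_isRightInversion (cs : CoxeterSystem M W) (w : W) :
    {t | cs.IsRightInversion w t}.Finite := by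
  obtain ⟨ω, hω, rfl⟩ := cs.exists_isReduced w
  simp only [isRightInversion_wordProd_iff_mem cs hω]
  exact List.finite_toSet _

lemma ncard_setOf_isRightInversion (cs : CoxeterSystem M W) (w : W) :
    {t | cs.IsRightInversion w t}.ncard = cs.length w := by
  classical
  obtain ⟨ω, hω, rfl⟩ := cs.exists_isReduced w
  have h : {t | cs.IsRightInversion (cs.wordProd ω) t} = ((cs.rightInvSeq ω).toFinset : Set W) := by
    ext t
    simp [isRightInversion_wordProd_iff_mem cs hω]
  rw [h, Set.ncard_coe_finset, List.toFinset_card_of_nodup hω.nodup_rightInvSeq,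
    cs.length_rightInvSeq, hω.eq]

end InversionParity

/-! ### Distances and walls -/

lemma d_comm (cs : CoxeterSystem M W) (u v : W) : d cs u v = d cs v u := by
  rw [d, d, ← cs.length_inv, mul_inv_rev, inv_inv]

lemma d_self (cs : CoxeterSystem M W) (u : W) : d cs u u = 0 := by simp [d]

lemma eq_of_d_eq_zero (cs : CoxeterSystem M W) {u v : W} (h : d cs u v = 0) : u = v := by
  rw [d, cs.length_eq_zero_iff, inv_mul_eq_one] at h
  exact h

lemma d_triangle (cs : CoxeterSystem M W) (u v w : W) : d cs u w ≤ d cs u v + d cs v w := by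
  have h := cs.length_mul_le (u⁻¹ * v) (v⁻¹ * w)
  rwa [mul_assoc, mul_inv_cancel_left] at h

lemma d_mul_left (cs : CoxeterSystem M W) (t u v : W) : d cs (t * u) (t * v) = d cs u v := by
  simp [d, mul_assoc]

lemma d_mul_simple (cs : CoxeterSystem M W) (u : W) (i : B) : d cs u (u * cs.simple i) = 1 := by
  simp [d]

lemma SeparatesPts.symm {cs : CoxeterSystem M W} {t u v : W} (h : SeparatesPts cs t u v) :
    SeparatesPts cs t v u := fun h' => h (Iff.symm h')

lemma isRightInversion_inv_mul_iff_separatesPts (cs : CoxeterSystem M W) {t : W}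
    (ht : cs.IsReflection t) (u v : W) :
    cs.IsRightInversion (u⁻¹ * v) (v⁻¹ * t * v) ↔ SeparatesPts cs t u v := by
  have hside : ∀ x, cs.length (t * x) < cs.length x ↔ invParity cs x⁻¹ t = 1 := by
    intro x
    rw [← isRightInversion_iff_invParity cs ht, cs.isRightInversion_inv_iff]
    exact ⟨fun h => ⟨ht, h⟩, fun h => h.2⟩
  have hconj : cs.IsReflection (v⁻¹ * t * v) := by simpa using ht.conj v⁻¹
  have hmul := invParity_mul cs (u⁻¹ * v) v⁻¹ t
  rw [inv_inv, mul_inv_cancel_right] at hmul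
  rw [isRightInversion_iff_invParity cs hconj, SeparatesPts, SameSide, hside, hside, hmul]
  generalize invParity cs v⁻¹ t = x
  generalize invParity cs (u⁻¹ * v) (v⁻¹ * t * v) = y
  revert x y
  decide

lemma separatesPts_iff_d_lt (cs : CoxeterSystem M W) {t : W} (ht : cs.IsReflection t) (u v : W) :
    SeparatesPts cs t u v ↔ d cs u (t * v) < d cs u v := by
  have hconj : cs.IsReflection (v⁻¹ * t * v) := by simpa using ht.conj v⁻¹
  rw [← isRightInversion_inv_mul_iff_separatesPts cs ht, CoxeterSystem.IsRightInversion, d, d,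
    and_iff_right hconj]
  simp [mul_assoc]

lemma SeparatesPts.mul_eq {cs : CoxeterSystem M W} {t u v : W} (ht : cs.IsReflection t)
    (h : SeparatesPts cs t u v) (huv : Adj cs u v) : t * u = v := by
  obtain ⟨i, rfl⟩ := huv
  rw [separatesPts_iff_d_lt cs ht, d_mul_simple, Nat.lt_one_iff] at h
  have h' := eq_of_d_eq_zero cs h
  rw [← mul_assoc, ← mul_inv_eq_iff_eq_mul, cs.inv_simple] at h'
  exact h'.symm

lemma finite_setOf_separatesPts (cs : CoxeterSystem M W) (u v : W) :
    {t | cs.IsReflection t ∧ SeparatesPts cs t u v}.Finite := by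
  refine ((finite_setOf_isRightInversion cs (u⁻¹ * v)).image fun t => v * t * v⁻¹).subset ?_
  rintro t ⟨ht, hs⟩
  exact ⟨v⁻¹ * t * v, (isRightInversion_inv_mul_iff_separatesPts cs ht u v).2 hs,
    by simp [mul_assoc]⟩

lemma ncard_setOf_separatesPts (cs : CoxeterSystem M W) (u v : W) :
    {t | cs.IsReflection t ∧ SeparatesPts cs t u v}.ncard = d cs u v := by
  have himage : {t | cs.IsReflection t ∧ SeparatesPts cs t u v} =
      MulAut.conj v '' {t | cs.IsRightInversion (u⁻¹ * v) t} := by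
    ext t
    constructor
    · rintro ⟨ht, hs⟩
      exact ⟨v⁻¹ * t * v, (isRightInversion_inv_mul_iff_separatesPts cs ht u v).2 hs,
        by simp [mul_assoc]⟩
    · rintro ⟨r, hr, rfl⟩
      have hrefl : cs.IsReflection (MulAut.conj v r) := hr.1.conj v
      refine ⟨hrefl, (isRightInversion_inv_mul_iff_separatesPts cs hrefl u v).1 ?_⟩
      simpa [mul_assoc] using hr
  rw [himage, Set.ncard_image_of_injective _ (MulAut.conj v).injective,
    ncard_setOf_isRightInversion, d]

/-- Twice the number of walls separating `x` from both `a` and `b` is the excess in the triangle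
inequality. -/
lemma d_add_d_eq (cs : CoxeterSystem M W) (a x b : W) :
    d cs a x + d cs x b = d cs a b +
      2 * {t | cs.IsReflection t ∧ SeparatesPts cs t a x ∧ SeparatesPts cs t x b}.ncard := by
  have hA := finite_setOf_separatesPts cs a x
  have hB := finite_setOf_separatesPts cs x b
  rw [← ncard_setOf_separatesPts cs a x, ← ncard_setOf_separatesPts cs x b,
    ← ncard_setOf_separatesPts cs a b]
  set A := {t | cs.IsReflection t ∧ SeparatesPts cs t a x} with hAdef
  set C := {t | cs.IsReflection t ∧ SeparatesPts cs t x b} with hCdef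
  have hI : {t | cs.IsReflection t ∧ SeparatesPts cs t a x ∧ SeparatesPts cs t x b} = A ∩ C := by
    ext t
    simp only [hAdef, hCdef, Set.mem_ofPred_eq, Set.mem_inter_iff]
    tauto
  have hD : {t | cs.IsReflection t ∧ SeparatesPts cs t a b} = (A \ C) ∪ (C \ A) := by
    ext t
    simp only [hAdef, hCdef, Set.mem_ofPred_eq, Set.mem_union, Set.mem_sdiff, SeparatesPts, SameSide]
    tauto
  have h1 := Set.ncard_inter_add_ncard_sdiff_eq_ncard A C hA
  have h2 := Set.ncard_inter_add_ncard_sdiff_eq_ncard C A hB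
  rw [hI, hD, Set.ncard_union_eq (Set.disjoint_left.2 fun t h h' => h.2 h'.1)
    (hA.subset Set.sdiff_subset) (hB.subset Set.sdiff_subset)]
  rw [Set.inter_comm] at h2
  lia

lemma exists_separatesPts_of_ne (cs : CoxeterSystem M W) {a x b : W}
    (h : d cs a x + d cs x b ≠ d cs a b) :
    ∃ t, cs.IsReflection t ∧ SeparatesPts cs t a x ∧ SeparatesPts cs t x b := by
  by_contra! hne
  apply h
  have hempty : {t | cs.IsReflection t ∧ SeparatesPts cs t a x ∧ SeparatesPts cs t x b} = ∅ :=
    Set.eq_empty_of_forall_notMem fun t ht => hne t ht.1 ht.2.1 ht.2.2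
  simpa [hempty] using d_add_d_eq cs a x b

lemma d_add_d_mul_left_lt (cs : CoxeterSystem M W) {t a x b : W} (ht : cs.IsReflection t)
    (ha : SeparatesPts cs t a x) (hb : SeparatesPts cs t x b) :
    d cs a (t * x) + d cs (t * x) b + 2 ≤ d cs a x + d cs x b := by
  have h1 := (separatesPts_iff_d_lt cs ht a x).1 ha
  have h2 := (separatesPts_iff_d_lt cs ht b x).1 hb.symm
  rw [d_comm cs (t * x) b, d_comm cs x b]
  lia

lemma not_separatesPts_of_d_add_d_eq (cs : CoxeterSystem M W) {t a x b : W}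
    (ht : cs.IsReflection t) (h : d cs a x + d cs x b = d cs a b) (ha : SeparatesPts cs t a x) :
    ¬ SeparatesPts cs t x b := by
  intro hb
  have h1 := d_add_d_mul_left_lt cs ht ha hb
  have h2 := d_triangle cs a (t * x) b
  lia

/-- The interval between two vertices is convex. -/
lemma interval_convex (cs : CoxeterSystem M W) {a b u w z : W}
    (hu : d cs a u + d cs u b = d cs a b) (hw : d cs a w + d cs w b = d cs a b)
    (hz : d cs u z + d cs z w = d cs u w) : d cs a z + d cs z b = d cs a b := by
  by_contra hne
  obtain ⟨t, ht, ha, hb⟩ := exists_separatesPts_of_ne cs hne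
  have h1 := not_separatesPts_of_d_add_d_eq cs ht hu
  have h2 := not_separatesPts_of_d_add_d_eq cs ht hw
  have h3 := not_separatesPts_of_d_add_d_eq cs ht hz
  unfold SeparatesPts SameSide at *
  tauto

/-! ### Edge paths -/

lemma IsPath.d_le {cs : CoxeterSystem M W} {v : ℕ → W} {n : ℕ} (hv : IsPath cs v n) {i j : ℕ}
    (hij : i ≤ j) (hj : j ≤ n) : d cs (v i) (v j) ≤ j - i := by
  induction j, hij using Nat.le_induction with
  | base => simp [d_self]
  | succ j hij ih =>
    have h1 := ih (by lia)
    obtain ⟨s, hs⟩ := hv j (by lia)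
    have h2 := d_triangle cs (v i) (v j) (v (j + 1))
    rw [hs, d_mul_simple, ← hs] at h2
    lia

lemma IsPath.exists_edge {cs : CoxeterSystem M W} {v : ℕ → W} {n : ℕ} (hv : IsPath cs v n) {t : W}
    (ht : cs.IsReflection t) {i j : ℕ} (hij : i ≤ j) (hj : j ≤ n)
    (h : SeparatesPts cs t (v i) (v j)) :
    ∃ k, i ≤ k ∧ k < j ∧ EdgeInWall cs t (v k) (v (k + 1)) := by
  induction j, hij using Nat.le_induction with
  | base => exact absurd Iff.rfl h
  | succ j hij ih =>
    by_cases h' : SeparatesPts cs t (v i) (v j)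
    · obtain ⟨k, h1, h2, h3⟩ := ih (by lia) h'
      exact ⟨k, h1, by lia, h3⟩
    · refine ⟨j, hij, by lia, hv j (by lia), SeparatesPts.mul_eq ht ?_ (hv j (by lia))⟩
      unfold SeparatesPts SameSide at *
      tauto

lemma EdgeInWall.inWallBar {cs : CoxeterSystem M W} {t u v : W} (h : EdgeInWall cs t u v) :
    InWallBar cs t u := by
  obtain ⟨⟨i, hi⟩, h⟩ := h
  exact ⟨i, h.trans hi⟩

lemma exists_geodesic (cs : CoxeterSystem M W) (u v : W) :
    ∃ g : ℕ → W, IsPath cs g (d cs u v) ∧ g 0 = u ∧ g (d cs u v) = v := by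
  obtain ⟨ω, hω, h⟩ := cs.exists_isReduced (u⁻¹ * v)
  have hd : d cs u v = ω.length := by rw [d, h, hω.eq]
  refine ⟨fun k => u * cs.wordProd (ω.take k), fun k hk => ?_, by simp, ?_⟩
  · rw [hd] at hk
    refine ⟨ω[k], ?_⟩
    simp only [← List.take_concat_get hk, cs.wordProd_concat, mul_assoc]
  · simp [hd, ← h]

lemma d_add_d_of_geodesic {cs : CoxeterSystem M W} {g : ℕ → W} {u v : W}
    (hg : IsPath cs g (d cs u v)) (h0 : g 0 = u) (h1 : g (d cs u v) = v) {k : ℕ}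
    (hk : k ≤ d cs u v) : d cs u (g k) + d cs (g k) v = d cs u v := by
  have h2 := hg.d_le (Nat.zero_le k) hk
  have h3 := hg.d_le hk le_rfl
  have h4 := d_triangle cs u (g k) v
  rw [h0] at h2
  rw [h1] at h3
  lia

lemma finite_brackets (cs : CoxeterSystem M W) (v : ℕ → W) (n k : ℕ) :
    (Brackets cs v n k).Finite := by
  refine ((Finset.range k).finite_toSet.image fun j => v (j + 1) * (v j)⁻¹).subset ?_
  rintro t ⟨j, m, hj, -, -, h, -⟩
  exact ⟨j, by simpa using hj, by simp [← h.2]⟩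

lemma d_add_d_le_of_brackets (cs : CoxeterSystem M W) {v : ℕ → W} {n k : ℕ}
    (hv : IsPath cs v n) (hk : k ≤ n) :
    d cs (v 0) (v k) + d cs (v k) (v n) ≤
      d cs (v 0) (v n) + 2 * (Brackets cs v n k).ncard := by
  rw [d_add_d_eq]
  gcongr
  · exact finite_brackets cs v n k
  · rintro t ⟨ht, h1, h2⟩
    obtain ⟨j, -, hj, hje⟩ := hv.exists_edge ht (Nat.zero_le k) hk h1
    obtain ⟨m, hm, hmn, hme⟩ := hv.exists_edge ht hk le_rfl h2
    exact ⟨j, m, hj, hm, hmn, hje, hme⟩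

/-! ### Folding towards an interval -/

lemma exists_inWallBar_d_eq_wallDist (cs : CoxeterSystem M W) {t : W} (ht : cs.IsReflection t)
    (x : W) : ∃ q, InWallBar cs t q ∧ d cs x q = wallDist cs t x := by
  obtain ⟨w, i, rfl⟩ := ht
  have hne : {n : ℕ | ∃ q, InWallBar cs (w * cs.simple i * w⁻¹) q ∧ d cs x q = n}.Nonempty :=
    ⟨_, w, ⟨i, by simp⟩, rfl⟩
  exact Nat.sInf_mem hne

lemma wallDist_le (cs : CoxeterSystem M W) {t q : W} (hq : InWallBar cs t q) (x : W) :
    wallDist cs t x ≤ d cs x q :=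
  Nat.sInf_le ⟨q, hq, rfl⟩

lemma d_mul_left_le (cs : CoxeterSystem M W) {t : W} (ht : cs.IsReflection t) (x : W) :
    d cs x (t * x) ≤ 2 * wallDist cs t x + 1 := by
  obtain ⟨q, ⟨i, hi⟩, hd⟩ := exists_inWallBar_d_eq_wallDist cs ht x
  have h1 := d_triangle cs x q (t * x)
  have h2 := d_triangle cs q (t * q) (t * x)
  rw [d_mul_left, d_comm cs q x, hi, d_mul_simple] at h2
  lia

lemma wallDist_lt_of_sepWallFromPt (cs : CoxeterSystem M W) {r t x : W} (ht : cs.IsReflection t)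
    (hr : cs.IsReflection r) (h : SepWallFromPt cs r t x) :
    wallDist cs r x < wallDist cs t x := by
  obtain ⟨q, hq, hd⟩ := exists_inWallBar_d_eq_wallDist cs ht x
  obtain ⟨g, hg, h0, h1⟩ := exists_geodesic cs x q
  have hs : SeparatesPts cs r (g 0) (g (d cs x q)) := by
    rw [h0, h1]
    exact (h q hq).symm
  obtain ⟨k, -, hk, he⟩ := hg.exists_edge hr (Nat.zero_le _) le_rfl hs
  have h2 := wallDist_le cs he.inWallBar x
  have h3 := hg.d_le (Nat.zero_le k) hk.le
  rw [h0] at h3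
  lia

lemma separatesPts_of_sepWallFromPt (cs : CoxeterSystem M W) {r t x a : W}
    (ht : cs.IsReflection t) (hr : cs.IsReflection r) (h : SepWallFromPt cs r t x)
    (ha : SeparatesPts cs t a x) : SeparatesPts cs r a x := by
  obtain ⟨g, hg, h0, h1⟩ := exists_geodesic cs a x
  have hs : SeparatesPts cs t (g 0) (g (d cs a x)) := by rwa [h0, h1]
  obtain ⟨k, -, hk, he⟩ := hg.exists_edge ht (Nat.zero_le _) le_rfl hs
  have h2 := h _ he.inWallBar
  have h3 := not_separatesPts_of_d_add_d_eq cs hr (d_add_d_of_geodesic hg h0 h1 hk.le)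
  unfold SeparatesPts SameSide at *
  tauto

lemma exists_separatesPts_wallDist_lt (cs : CoxeterSystem M W) {P : ℕ → ℕ}
    (hP : IsParallelWallFn cs P) {a x b : W} (h : d cs a x + d cs x b ≠ d cs a b) :
    ∃ t, cs.IsReflection t ∧ SeparatesPts cs t a x ∧ SeparatesPts cs t x b ∧
      wallDist cs t x < P 1 := by
  obtain ⟨t, ⟨ht, ha, hb⟩, hmin⟩ := (measure fun t => wallDist cs t x).wf.has_min
    {t | cs.IsReflection t ∧ SeparatesPts cs t a x ∧ SeparatesPts cs t x b}
    (exists_separatesPts_of_ne cs h)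
  refine ⟨t, ht, ha, hb, ?_⟩
  by_contra! hle
  obtain ⟨T, hT, hrefl, -, hsep⟩ := hP 1 one_pos t x ht hle
  obtain ⟨r, rfl⟩ := Finset.card_eq_one.1 hT
  have hr := hrefl r (Finset.mem_singleton_self r)
  have hs := hsep r (Finset.mem_singleton_self r)
  exact hmin r ⟨hr, separatesPts_of_sepWallFromPt cs ht hr hs ha,
    (separatesPts_of_sepWallFromPt cs ht hr hs hb.symm).symm⟩
    (wallDist_lt_of_sepWallFromPt cs ht hr hs)

/-- A vertex separated from both `a` and `b` by at most `k` walls is within `(2 P 1 + 1) k` of the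
interval between `a` and `b`. -/
lemma exists_interval_near (cs : CoxeterSystem M W) {P : ℕ → ℕ} (hP : IsParallelWallFn cs P)
    {a b : W} (k : ℕ) (x : W) (h : d cs a x + d cs x b ≤ d cs a b + 2 * k) :
    ∃ y, d cs a y + d cs y b = d cs a b ∧ d cs y x ≤ (2 * P 1 + 1) * k := by
  induction k generalizing x with
  | zero => exact ⟨x, le_antisymm h (d_triangle cs a x b), by simp [d_self]⟩
  | succ k ih =>
    by_cases heq : d cs a x + d cs x b = d cs a b
    · exact ⟨x, heq, by simp [d_self]⟩
    · obtain ⟨t, ht, ha, hb, hlt⟩ := exists_separatesPts_wallDist_lt cs hP heq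
      have h1 := d_add_d_mul_left_lt cs ht ha hb
      obtain ⟨y, hy, hyd⟩ := ih (t * x) (by lia)
      have h2 := d_mul_left_le cs ht x
      have h3 := d_triangle cs y (t * x) x
      rw [d_comm cs (t * x) x] at h3
      refine ⟨y, hy, ?_⟩
      rw [mul_add, mul_one]
      lia

/-- The number of edges of a path joining the first `i + 1` vertices of `y` by geodesics. -/
noncomputable def joinLength (cs : CoxeterSystem M W) (y : ℕ → W) (i : ℕ) : ℕ :=
  ∑ l ∈ Finset.range i, d cs (y l) (y (l + 1))

lemma joinLength_succ (cs : CoxeterSystem M W) (y : ℕ → W) (i : ℕ) :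
    joinLength cs y (i + 1) = joinLength cs y i + d cs (y i) (y (i + 1)) :=
  Finset.sum_range_succ _ _

lemma joinLength_mono (cs : CoxeterSystem M W) (y : ℕ → W) : Monotone (joinLength cs y) :=
  monotone_nat_of_le_succ fun i => by simp [joinLength_succ]

/-- Consecutive vertices of a sequence can be joined by geodesics to form an edge path, every
vertex of which lies on a geodesic between two vertices of the sequence. -/
lemma exists_path_through (cs : CoxeterSystem M W) (y : ℕ → W) (n : ℕ) :
    ∃ w : ℕ → W, IsPath cs w (joinLength cs y n) ∧
      (∀ i, i ≤ n → w (joinLength cs y i) = y i) ∧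
      ∀ k, k ≤ joinLength cs y n → ∃ i ≤ n, ∃ j ≤ n,
        d cs (y i) (w k) + d cs (w k) (y j) = d cs (y i) (y j) := by
  induction n with
  | zero =>
    refine ⟨fun _ => y 0, fun k hk => absurd hk (by simp [joinLength]), by simp, ?_⟩
    exact fun k _ => ⟨0, le_rfl, 0, le_rfl, by simp [d_self]⟩
  | succ n ih =>
    obtain ⟨w, hw, hwy, hbetween⟩ := ih
    obtain ⟨g, hg, hg0, hg1⟩ := exists_geodesic cs (y n) (y (n + 1))
    set c := joinLength cs y with hc
    have hsucc : c (n + 1) = c n + d cs (y n) (y (n + 1)) := joinLength_succ cs y n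
    have hglue : ∀ k, (if c n + k ≤ c n then w (c n + k) else g (c n + k - c n)) = g k := by
      intro k
      rcases Nat.eq_zero_or_pos k with rfl | hk
      · simp [hg0, hwy]
      · rw [if_neg (by lia), Nat.add_sub_cancel_left]
    refine ⟨fun k => if k ≤ c n then w k else g (k - c n), fun k hk => ?_, fun i hi => ?_,
      fun k hk => ?_⟩
    · rcases lt_or_ge k (c n) with hlt | hge
      · simp only [hlt.le, Nat.succ_le_of_lt hlt, if_true]
        exact hw k hlt
      · obtain ⟨l, rfl⟩ := Nat.exists_eq_add_of_le hge
        simp only [add_assoc, hglue]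
        exact hg l (by lia)
    · rcases Nat.le_succ_iff.1 hi with hle | rfl
      · simp only [joinLength_mono cs y hle, hc, if_true]
        exact hwy i hle
      · simp only [hsucc, hglue]
        exact hg1
    · rcases le_or_gt k (c n) with hle | hgt
      · obtain ⟨i, hi, j, hj, h⟩ := hbetween k hle
        refine ⟨i, by lia, j, by lia, ?_⟩
        simpa only [hle, if_true] using h
      · obtain ⟨l, rfl⟩ := Nat.exists_eq_add_of_le hgt.le
        refine ⟨n, by lia, n + 1, le_rfl, ?_⟩
        simp only [hglue]
        exact d_add_d_of_geodesic hg hg0 hg1 (by lia)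

/-- For every edge path `α = v 0, …, v n` connecting `a` and `b` there is an
`L`-approximation `β` of `α` such that every vertex of `β` lies on a geodesic
connecting `a` and `b`, and `L ≤ (2 P 1 + 1) · B(α)`. -/
theorem rightside {B : Type*} {W : Type*} [Group W] [Finite B]
    {M : CoxeterMatrix B} (cs : CoxeterSystem M W)
    (P : ℕ → ℕ) (hP : IsParallelWallFn cs P)
    (v : ℕ → W) (n : ℕ) (hpath : IsPath cs v n)
    (BA : ℕ) (hB : ∀ k, k ≤ n → (Brackets cs v n k).ncard ≤ BA) :
    ∃ (L : ℕ) (w : ℕ → W) (m : ℕ) (c : ℕ → ℕ),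
      IsApprox cs L v n w m c ∧
      L ≤ (2 * P 1 + 1) * BA ∧
      (∀ k, k ≤ m → d cs (v 0) (w k) + d cs (w k) (v n) = d cs (v 0) (v n)) := by
  have hnear : ∀ k, ∃ y, k ≤ n → d cs (v 0) y + d cs y (v n) = d cs (v 0) (v n) ∧
      d cs y (v k) ≤ (2 * P 1 + 1) * (Brackets cs v n k).ncard := by
    intro k
    by_cases hk : k ≤ n
    · obtain ⟨y, hy⟩ := exists_interval_near cs hP _ (v k) (d_add_d_le_of_brackets cs hpath hk)
      exact ⟨y, fun _ => hy⟩
    · exact ⟨v k, fun h => absurd h hk⟩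
  choose y hy using hnear
  have hend : ∀ k, k ≤ n → Brackets cs v n k = ∅ → y k = v k := by
    intro k hk hempty
    have h := (hy k hk).2
    rw [hempty, Set.ncard_empty, mul_zero, Nat.le_zero] at h
    exact eq_of_d_eq_zero cs h
  have hy0 : y 0 = v 0 := by
    refine hend 0 (Nat.zero_le n) (Set.eq_empty_of_forall_notMem ?_)
    rintro t ⟨j, m, hj, -⟩
    exact absurd hj (Nat.not_lt_zero j)
  have hyn : y n = v n := by
    refine hend n le_rfl (Set.eq_empty_of_forall_notMem ?_)
    rintro t ⟨j, m, -, hm, hmn, -⟩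
    exact absurd hmn hm.not_gt
  obtain ⟨w, hw, hwy, hbetween⟩ := exists_path_through cs y n
  refine ⟨(2 * P 1 + 1) * BA, w, joinLength cs y n, joinLength cs y,
    ⟨hw, by simp [joinLength], rfl, fun i _ => joinLength_mono cs y i.le_succ,
      (hwy 0 (Nat.zero_le n)).trans hy0, (hwy n le_rfl).trans hyn, fun i hi => ?_,
      fun i hi => ?_⟩, le_rfl, fun k hk => ?_⟩
  · rw [hwy i hi]
    exact (hy i hi).2.trans (Nat.mul_le_mul_left _ (hB i hi))
  · rw [hwy i hi.le, hwy (i + 1) hi, joinLength_succ, Nat.add_sub_cancel_left]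
  · obtain ⟨i, hi, j, hj, h⟩ := hbetween k hk
    exact interval_convex cs (hy i hi).1 (hy j hj).1 h

end CoxTrack
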